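/- Let X be a real Banach space and let F : [0,1] → 2^X \ {∅} be a compact-valued bounded multifunction. Then I(F) = I(conv F). -/

import Mathlib

open Pointwise Filter Metric Set

/-- A tagged partition of `[0,1]` into finitely many segments with tags. -/
structure TaggedPartition where
  n : ℕ
  pt : Fin (n + 1) → ℝ
  tag : Fin n → ℝ
  pt_zero : pt 0 = 0
  pt_last : pt (Fin.last n) = 1
  pt_mono : Monotone pt
  tag_mem : ∀ i : Fin n, tag i ∈ Set.Icc (pt i.castSucc) (pt i.succ)

/-- The diameter (mesh) of a tagged partition. -/
noncomputable def TaggedPartition.mesh (P : TaggedPartition) : ℝ :=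
  ⨆ i : Fin P.n, (P.pt i.succ - P.pt i.castSucc)

/-- Riemann integral sum of a multifunction, using Minkowski sums and
pointwise scalar multiples of sets. -/
noncomputable def msum {X : Type*} [NormedAddCommGroup X] [NormedSpace ℝ X]
    (F : ℝ → Set X) (P : TaggedPartition) : Set X :=
  ∑ i : Fin P.n, (P.pt i.succ - P.pt i.castSucc) • F (P.tag i)

/-- The set `I(F)` of limits of Riemann integral sums of a multifunction `F`:
all closed nonempty subsets that are Hausdorff-distance limits of sequences of Riemann
sums along sequences of tagged partitions whose diameters tend to `0`. -/
def limitSets {X : Type*} [NormedAddCommGroup X] [NormedSpace ℝ X]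
    (F : ℝ → Set X) : Set (Set X) :=
  {A | A.Nonempty ∧ IsClosed A ∧ ∃ P : ℕ → TaggedPartition,
    Tendsto (fun k => (P k).mesh) atTop (nhds 0) ∧
    Tendsto (fun k => EMetric.hausdorffEdist (msum F (P k)) A) atTop (nhds 0)}

namespace TaggedPartition

variable (P : TaggedPartition)

theorem length_nonneg (i : Fin P.n) : 0 ≤ P.pt i.succ - P.pt i.castSucc :=
  sub_nonneg.2 (P.pt_mono i.castSucc_lt_succ.le)

theorem length_le_mesh (i : Fin P.n) : P.pt i.succ - P.pt i.castSucc ≤ P.mesh :=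
  le_ciSup (f := fun i : Fin P.n => P.pt i.succ - P.pt i.castSucc)
    (Set.finite_range _).bddAbove i

theorem sum_length : ∑ i : Fin P.n, (P.pt i.succ - P.pt i.castSucc) = 1 := by
  have h₁ := Fin.sum_univ_succ P.pt
  have h₂ := Fin.sum_univ_castSucc P.pt
  rw [P.pt_zero] at h₁
  rw [P.pt_last] at h₂
  rw [Finset.sum_sub_distrib]
  linarith

theorem tag_mem_Icc (i : Fin P.n) : P.tag i ∈ Set.Icc (0 : ℝ) 1 := by
  have h := P.tag_mem i
  refine ⟨?_, ?_⟩
  · rw [← P.pt_zero]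
    exact (P.pt_mono (Fin.zero_le _)).trans h.1
  · rw [← P.pt_last]
    exact h.2.trans (P.pt_mono (Fin.le_last _))

end TaggedPartition

section

variable {X : Type*} [NormedAddCommGroup X] [NormedSpace ℝ X]

theorem msum_convexHull (F : ℝ → Set X) (P : TaggedPartition) :
    msum (fun t => convexHull ℝ (F t)) P = convexHull ℝ (msum F P) := by
  simp only [msum, convexHull_sum, convexHull_smul]

theorem totallyBounded_msum {F : ℝ → Set X} (hF : ∀ t ∈ Set.Icc (0 : ℝ) 1, IsCompact (F t))
    (P : TaggedPartition) : TotallyBounded (msum F P) := by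
  have key : ∀ s : Finset (Fin P.n),
      IsCompact (∑ i ∈ s, (P.pt i.succ - P.pt i.castSucc) • F (P.tag i)) := by
    intro s
    induction s using Finset.cons_induction with
    | empty => simp
    | cons i s hi ih =>
      rw [Finset.sum_cons]
      exact ((hF _ (P.tag_mem_Icc i)).smul _).add ih
  exact (key Finset.univ).totallyBounded

/-- On a compact set the norm is, up to `ε`, a maximum of finitely many functionals of norm at
most one. -/
theorem IsCompact.exists_finset_strongDual_norm_le {K : Set X} (hK : IsCompact K) {ε : ℝ}
    (hε : 0 < ε) :
    ∃ G : Finset (StrongDual ℝ X), (∀ f ∈ G, ‖f‖ ≤ 1) ∧ ∀ x ∈ K, ∃ f ∈ G, ‖x‖ ≤ f x + ε := by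
  classical
  obtain ⟨t, -, htfin, ht⟩ := Metric.finite_approx_of_totallyBounded hK.totallyBounded
    (ε / 2) (half_pos hε)
  choose g hg hgx using fun x : X => exists_dual_vector'' ℝ x
  refine ⟨htfin.toFinset.image g, ?_, ?_⟩
  · intro f hf
    obtain ⟨y, -, rfl⟩ := Finset.mem_image.1 hf
    exact hg y
  · intro x hx
    obtain ⟨y, hy, hxy⟩ := Set.mem_iUnion₂.1 (ht hx)
    refine ⟨g y, Finset.mem_image_of_mem g (htfin.mem_toFinset.2 hy), ?_⟩
    rw [Metric.mem_ball, dist_eq_norm] at hxy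
    have h₁ : ‖x‖ ≤ ‖x - y‖ + ‖y‖ := by simpa using norm_add_le (x - y) y
    have h₂ : g y y = ‖y‖ := hgx y
    have h₃ : g y (y - x) ≤ ‖x - y‖ := by
      rw [norm_sub_rev]
      exact (le_abs_self _).trans ((g y).le_of_opNorm_le (hg y) _ |>.trans (one_mul _).le)
    rw [map_sub] at h₃
    linarith

/-- Points of convex hulls can be replaced one after the other by points of the sets themselves so
that the squared errors, measured by finitely many functionals, at most add up. -/
theorem exists_mem_sum_sq_map_sum_sub_le {ι : Type*} (s : Finset ι) (A : ι → Set X) (u : ι → X)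
    (hu : ∀ i ∈ s, u i ∈ convexHull ℝ (A i)) (G : Finset (StrongDual ℝ X)) :
    ∃ v : ι → X, (∀ i ∈ s, v i ∈ A i) ∧
      ∑ f ∈ G, (f (∑ i ∈ s, (u i - v i))) ^ 2 ≤ ∑ i ∈ s, ∑ f ∈ G, (f (u i - v i)) ^ 2 := by
  classical
  induction s using Finset.cons_induction with
  | empty => exact ⟨u, by simp, by simp⟩
  | cons j s hj ih =>
    obtain ⟨v, hv, hle⟩ := ih fun i hi => hu i (Finset.mem_cons_of_mem hi)
    set w := ∑ i ∈ s, (u i - v i) with hw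
    let φ : StrongDual ℝ X := ∑ f ∈ G, f w • f
    obtain ⟨y, hy, hφ⟩ := (φ.toLinearMap.convexOn convex_univ).exists_ge_of_mem_convexHull
      (Set.subset_univ (A j)) (hu j (Finset.mem_cons_self j s))
    have hφ' : ∑ f ∈ G, f w * f (u j - y) ≤ 0 := by
      have : φ (u j - y) ≤ 0 := by
        rw [map_sub]
        exact sub_nonpos.2 hφ
      simpa [φ] using this
    have hne : ∀ i ∈ s, i ≠ j := fun i hi h => hj (h ▸ hi)
    refine ⟨Function.update v j y, ?_, ?_⟩
    · intro i hi
      rcases Finset.mem_cons.1 hi with rfl | hi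
      · simpa using hy
      · simpa [Function.update_of_ne (hne i hi)] using hv i hi
    · have h₁ : ∑ i ∈ s, (u i - Function.update v j y i) = w :=
        Finset.sum_congr rfl fun i hi => by rw [Function.update_of_ne (hne i hi)]
      have h₂ : ∑ i ∈ s, ∑ f ∈ G, (f (u i - Function.update v j y i)) ^ 2 =
          ∑ i ∈ s, ∑ f ∈ G, (f (u i - v i)) ^ 2 :=
        Finset.sum_congr rfl fun i hi => by rw [Function.update_of_ne (hne i hi)]
      rw [Finset.sum_cons, Finset.sum_cons, h₁, h₂, Function.update_self]
      have h₃ : ∑ f ∈ G, (f (u j - y + w)) ^ 2 = ∑ f ∈ G, (f (u j - y)) ^ 2 +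
          2 * ∑ f ∈ G, f w * f (u j - y) + ∑ f ∈ G, (f w) ^ 2 := by
        rw [Finset.mul_sum, ← Finset.sum_add_distrib, ← Finset.sum_add_distrib]
        refine Finset.sum_congr rfl fun f _ => ?_
        rw [map_add]
        ring
      linarith

theorem exists_mem_msum_sq_map_sub_le {F : ℝ → Set X} {M : ℝ}
    (hM : ∀ t ∈ Set.Icc (0 : ℝ) 1, ∀ a ∈ F t, ‖a‖ ≤ M) {G : Finset (StrongDual ℝ X)}
    (hG : ∀ f ∈ G, ‖f‖ ≤ 1) (P : TaggedPartition) {u : X}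
    (hu : u ∈ msum (fun t => convexHull ℝ (F t)) P) :
    ∃ v ∈ msum F P, ∀ f ∈ G, (f (u - v)) ^ 2 ≤ G.card * (2 * M) ^ 2 * P.mesh := by
  obtain ⟨g, hg, rfl⟩ := (Set.mem_fintype_sum _ _).1 hu
  let l : Fin P.n → ℝ := fun i => P.pt i.succ - P.pt i.castSucc
  have hl0 : ∀ i, 0 ≤ l i := P.length_nonneg
  have hg' : ∀ i ∈ Finset.univ, g i ∈ convexHull ℝ (l i • F (P.tag i)) := fun i _ => by
    rw [convexHull_smul]
    exact hg i
  obtain ⟨v, hv, hle⟩ := exists_mem_sum_sq_map_sum_sub_le Finset.univ _ g hg' G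
  have hball : ∀ i, l i • F (P.tag i) ⊆ Metric.closedBall 0 (l i * M) := by
    rintro i _ ⟨a, ha, rfl⟩
    rw [mem_closedBall_zero_iff, norm_smul, Real.norm_of_nonneg (hl0 i)]
    exact mul_le_mul_of_nonneg_left (hM _ (P.tag_mem_Icc i) a ha) (hl0 i)
  have hterm : ∀ i, ∀ f ∈ G, (f (g i - v i)) ^ 2 ≤ (2 * M) ^ 2 * P.mesh * l i := by
    intro i f hf
    have h₁ := convexHull_min (hball i) (convex_closedBall _ _) (hg' i (Finset.mem_univ i))
    have h₂ := hball i (hv i (Finset.mem_univ i))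
    rw [mem_closedBall_zero_iff] at h₁ h₂
    have h₃ : |f (g i - v i)| ≤ 2 * M * l i :=
      ((f.le_of_opNorm_le (hG f hf) _).trans (one_mul _).le).trans
        ((norm_sub_le _ _).trans (by linarith))
    calc (f (g i - v i)) ^ 2 = |f (g i - v i)| ^ 2 := (sq_abs _).symm
      _ ≤ (2 * M * l i) ^ 2 := by gcongr
      _ = (2 * M) ^ 2 * l i * l i := by ring
      _ ≤ (2 * M) ^ 2 * P.mesh * l i := by
        have := P.length_le_mesh i
        have := hl0 i
        gcongr
  refine ⟨∑ i, v i, (Set.mem_fintype_sum _ _).2 ⟨v, fun i => hv i (Finset.mem_univ i), rfl⟩, ?_⟩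
  intro f hf
  rw [← Finset.sum_sub_distrib]
  calc (f (∑ i, (g i - v i))) ^ 2 ≤ ∑ f ∈ G, (f (∑ i, (g i - v i))) ^ 2 :=
        Finset.single_le_sum (f := fun f : StrongDual ℝ X => (f (∑ i, (g i - v i))) ^ 2)
          (fun _ _ => sq_nonneg _) hf
    _ ≤ ∑ i, ∑ f ∈ G, (f (g i - v i)) ^ 2 := hle
    _ ≤ ∑ i, ∑ f ∈ G, (2 * M) ^ 2 * P.mesh * l i :=
        Finset.sum_le_sum fun i _ => Finset.sum_le_sum fun f hf => hterm i f hf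
    _ = G.card * (2 * M) ^ 2 * P.mesh * ∑ i, l i := by
        simp only [Finset.sum_const, nsmul_eq_mul, Finset.mul_sum]
        exact Finset.sum_congr rfl fun i _ => by ring
    _ = G.card * (2 * M) ^ 2 * P.mesh := by rw [P.sum_length, mul_one]

/-- If the Riemann sum of `conv F` is close to a fixed compact set and the mesh is small, then it
is close to the Riemann sum of `F`. -/
theorem exists_mesh_forall_exists_dist_msum_le {F : ℝ → Set X} {M : ℝ}
    (hM : ∀ t ∈ Set.Icc (0 : ℝ) 1, ∀ a ∈ F t, ‖a‖ ≤ M) {K : Set X} (hK : IsCompact K) {ε : ℝ}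
    (hε : 0 < ε) :
    ∃ δ > 0, ∀ P : TaggedPartition, P.mesh < δ →
      (∀ u ∈ msum (fun t => convexHull ℝ (F t)) P, ∃ a ∈ K, dist u a ≤ ε) →
      ∀ u ∈ msum (fun t => convexHull ℝ (F t)) P, ∃ v ∈ msum F P, dist u v ≤ 6 * ε := by
  obtain ⟨G, hG, hGK⟩ := (hK.add hK.neg).exists_finset_strongDual_norm_le hε
  have hC : 0 < (G.card : ℝ) * (2 * M) ^ 2 + 1 := by positivity
  refine ⟨ε ^ 2 / (G.card * (2 * M) ^ 2 + 1), by positivity, fun P hP hPK u hu => ?_⟩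
  obtain ⟨v, hv, huv⟩ := exists_mem_msum_sq_map_sub_le hM hG P hu
  refine ⟨v, hv, ?_⟩
  have hv' : v ∈ msum (fun t => convexHull ℝ (F t)) P := by
    rw [msum_convexHull]
    exact subset_convexHull ℝ _ hv
  obtain ⟨a, ha, hua⟩ := hPK u hu
  obtain ⟨b, hb, hvb⟩ := hPK v hv'
  obtain ⟨f, hf, hfab⟩ := hGK (a - b) <| by
    rw [sub_eq_add_neg]
    exact Set.add_mem_add ha (Set.neg_mem_neg.2 hb)
  rw [dist_eq_norm] at hua hvb ⊢
  have hfuv : f (u - v) ≤ ε := by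
    refine (le_abs_self _).trans (abs_le_of_sq_le_sq ((huv f hf).trans ?_) hε.le)
    have hmesh : P.mesh * (G.card * (2 * M) ^ 2 + 1) < ε ^ 2 := (lt_div_iff₀ hC).1 hP
    have h0 : 0 ≤ P.mesh := Real.iSup_nonneg P.length_nonneg
    linarith
  have herr : ‖(u - a) - (v - b)‖ ≤ 2 * ε := (norm_sub_le _ _).trans (by linarith)
  have hferr : f ((v - b) - (u - a)) ≤ 2 * ε := by
    refine (le_abs_self _).trans (((f.le_of_opNorm_le (hG f hf) _).trans (one_mul _).le).trans ?_)
    rwa [norm_sub_rev]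
  have hfsplit : f (a - b) = f (u - v) + f ((v - b) - (u - a)) := by
    rw [← map_add]
    congr 1
    abel
  have hsplit : u - v = (a - b) + ((u - a) - (v - b)) := by abel
  rw [hsplit]
  refine (norm_add_le _ _).trans ?_
  linarith

/-- Along partitions with mesh tending to zero, the Riemann sums of `F` and `conv F` approach each
other as soon as the latter approach a compact set. -/
theorem tendsto_hausdorffEDist_msum_convexHull {F : ℝ → Set X} {M : ℝ}
    (hM : ∀ t ∈ Set.Icc (0 : ℝ) 1, ∀ a ∈ F t, ‖a‖ ≤ M) {K : Set X} (hK : IsCompact K)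
    {P : ℕ → TaggedPartition} (hP : Tendsto (fun k => (P k).mesh) atTop (nhds 0))
    (hPK : ∀ ε > 0, ∀ᶠ k in atTop,
      ∀ u ∈ msum (fun t => convexHull ℝ (F t)) (P k), ∃ a ∈ K, dist u a ≤ ε) :
    Tendsto (fun k => Metric.hausdorffEDist (msum F (P k))
      (msum (fun t => convexHull ℝ (F t)) (P k))) atTop (nhds 0) := by
  rw [ENNReal.tendsto_nhds_zero]
  intro ε hε
  obtain ⟨r, -, hr0, hrε⟩ := ENNReal.lt_iff_exists_real_btwn.1 hε
  have hr : 0 < r := ENNReal.ofReal_pos.1 hr0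
  have hr6 : 0 < r / 6 := by positivity
  obtain ⟨δ, hδ, h⟩ := exists_mesh_forall_exists_dist_msum_le hM hK hr6
  filter_upwards [hP.eventually_lt_const hδ, hPK _ hr6] with k hk hkK
  refine le_trans (Metric.hausdorffEDist_le_of_mem_edist ?_ ?_) hrε.le
  · intro v hv
    refine ⟨v, ?_, by simp⟩
    rw [msum_convexHull]
    exact subset_convexHull ℝ _ hv
  · intro u hu
    obtain ⟨v, hv, huv⟩ := h (P k) hk hkK u hu
    refine ⟨v, hv, ?_⟩
    rw [edist_dist]
    exact ENNReal.ofReal_le_ofReal (by linarith)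

end

theorem totallyBounded_of_tendsto_hausdorffEDist {α ι : Type*} [PseudoEMetricSpace α]
    {l : Filter ι} [l.NeBot] {S : ι → Set α} {A : Set α} (hS : ∀ k, TotallyBounded (S k))
    (h : Tendsto (fun k => Metric.hausdorffEDist (S k) A) l (nhds 0)) : TotallyBounded A := by
  rw [EMetric.totallyBounded_iff]
  intro ε hε
  have hε2 : 0 < ε / 2 := ENNReal.half_pos hε.ne'
  obtain ⟨k, hk⟩ := (h.eventually_lt_const hε2).exists
  obtain ⟨t, ht, hSt⟩ := EMetric.totallyBounded_iff.1 (hS k) (ε / 2) hε2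
  refine ⟨t, ht, fun x hx => ?_⟩
  rw [Metric.hausdorffEDist_comm] at hk
  obtain ⟨y, hy, hxy⟩ := Metric.exists_edist_lt_of_hausdorffEDist_lt hx hk
  obtain ⟨z, hz, hyz⟩ := Set.mem_iUnion₂.1 (hSt hy)
  refine Set.mem_iUnion₂.2 ⟨z, hz, ?_⟩
  calc edist x z ≤ edist x y + edist y z := edist_triangle _ _ _
    _ < ε / 2 + ε / 2 := ENNReal.add_lt_add hxy hyz
    _ = ε := ENNReal.add_halves ε

theorem eventually_subset_thickening_of_tendsto_hausdorffEDist {α ι : Type*}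
    [PseudoMetricSpace α] {l : Filter ι} {S : ι → Set α} {A : Set α}
    (h : Tendsto (fun k => Metric.hausdorffEDist (S k) A) l (nhds 0)) {ε : ℝ} (hε : 0 < ε) :
    ∀ᶠ k in l, S k ⊆ Metric.thickening ε A := by
  filter_upwards [h.eventually_lt_const (ENNReal.ofReal_pos.2 hε)] with k hk x hx
  exact Metric.mem_thickening_iff_infEDist_lt.2
    ((Metric.infEDist_le_hausdorffEDist_of_mem hx).trans_lt hk)

/-- In any Banach space, every compact-valued bounded multifunction `F` on `[0,1]`
satisfies `I(F) = I(conv F)`. -/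
theorem limitSets_eq_limitSets_convexHull_of_compactValued
    {X : Type*} [NormedAddCommGroup X] [NormedSpace ℝ X] [CompleteSpace X]
    (F : ℝ → Set X)
    (hFne : ∀ t ∈ Set.Icc (0 : ℝ) 1, (F t).Nonempty)
    (hFcpt : ∀ t ∈ Set.Icc (0 : ℝ) 1, IsCompact (F t))
    (hFbdd : ∃ M : ℝ, ∀ t ∈ Set.Icc (0 : ℝ) 1, ∀ a ∈ F t, ‖a‖ ≤ M) :
    limitSets F = limitSets (fun t => convexHull ℝ (F t)) := by
  obtain ⟨M, hM⟩ := hFbdd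
  have htb : ∀ P, TotallyBounded (msum F P) := totallyBounded_msum hFcpt
  have hcompact : ∀ {A : Set X}, TotallyBounded A → IsCompact (closure (convexHull ℝ A)) :=
    fun hA => (totallyBounded_convexHull.2 hA).closure.isCompact_of_isClosed isClosed_closure
  have hclose : ∀ {A : Set X} {P : ℕ → TaggedPartition}, TotallyBounded A →
      Tendsto (fun k => (P k).mesh) atTop (nhds 0) →
      (∀ ε > 0, ∀ᶠ k in atTop, msum F (P k) ⊆ Metric.thickening ε A) →
      Tendsto (fun k => Metric.hausdorffEDist (msum F (P k))
        (msum (fun t => convexHull ℝ (F t)) (P k))) atTop (nhds 0) := by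
    intro A P hA hP hPA
    refine tendsto_hausdorffEDist_msum_convexHull hM (hcompact hA) hP fun ε hε => ?_
    filter_upwards [hPA ε hε] with k hk u hu
    rw [msum_convexHull] at hu
    have hsub : msum F (P k) ⊆ Metric.thickening ε (convexHull ℝ A) :=
      hk.trans (Metric.thickening_subset_of_subset ε (subset_convexHull ℝ A))
    obtain ⟨a, ha, hua⟩ := Metric.mem_thickening_iff.1
      (convexHull_min hsub ((convex_convexHull ℝ A).thickening ε) hu)
    exact ⟨a, subset_closure ha, hua.le⟩
  ext A
  constructor
  · rintro ⟨hne, hcl, P, hP, hPA⟩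
    refine ⟨hne, hcl, P, hP, ?_⟩
    have hA := totallyBounded_of_tendsto_hausdorffEDist (fun k => htb (P k)) hPA
    have h := hclose hA hP
      fun ε hε => eventually_subset_thickening_of_tendsto_hausdorffEDist hPA hε
    have hsum := h.add hPA
    rw [add_zero] at hsum
    refine tendsto_of_tendsto_of_tendsto_of_le_of_le tendsto_const_nhds hsum
      (fun _ => zero_le) fun k => ?_
    rw [Metric.hausdorffEDist_comm (s := msum F (P k)) (t := msum _ (P k))]
    exact Metric.hausdorffEDist_triangle
  · rintro ⟨hne, hcl, P, hP, hPA⟩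
    refine ⟨hne, hcl, P, hP, ?_⟩
    have hsub : ∀ k, msum F (P k) ⊆ msum (fun t => convexHull ℝ (F t)) (P k) := fun k => by
      rw [msum_convexHull]
      exact subset_convexHull ℝ _
    have hA := totallyBounded_of_tendsto_hausdorffEDist (fun k => by
      rw [msum_convexHull]
      exact totallyBounded_convexHull.2 (htb (P k))) hPA
    have h := hclose hA hP fun ε hε =>
      (eventually_subset_thickening_of_tendsto_hausdorffEDist hPA hε).mono
        fun k hk => (hsub k).trans hk
    have hsum := h.add hPA
    rw [add_zero] at hsum
    exact tendsto_of_tendsto_of_tendsto_of_le_of_le tendsto_const_nhds hsum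
      (fun _ => zero_le) fun k => Metric.hausdorffEDist_triangle
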